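/- For every integer k, the 4×4 integer matrix M_k = [[2, -1-3k, -3, -3], [-1+k, 1+k, 1, 2], [0, k, 1, 1], [k, k, 1, 2]] belongs to Sp(4, Z). Moreover, for the period matrix Ω = (i√3/3)·[[2, 1], [1, 2]] of the hyperelliptic curve y^2 = x^6 - 1, one has det(Ω) = -1, and writing Ω in blocks as above, det((AΩ+B)(CΩ+D)^{-1}) = ((1+3k^2)λ - 3)/(-k^2 λ + 1) evaluated at λ = det(Ω) = -1, where [[1+3k^2, -3], [-k^2, 1]] is an SL(2, Z) matrix. -/

import Mathlib

/-!
STATEMENT 14: For every integer k, the matrix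
M_k = [[2, −1−3k, −3, −3], [−1+k, 1+k, 1, 2], [0, k, 1, 1], [k, k, 1, 2]]
belongs to Sp(4,ℤ). Moreover, for the period matrix Ω = (i√3/3)·[[2,1],[1,2]] of the
hyperelliptic curve y² = x⁶ − 1, one has det(Ω) = −1 and, writing M_k in 2×2 blocks
[[A,B],[C,D]], det((AΩ+B)(CΩ+D)⁻¹) = ((1+3k²)λ − 3)/(−k²λ + 1) evaluated at
λ = det(Ω) = −1, where [[1+3k², −3], [−k², 1]] is an SL(2,ℤ) matrix.
-/

open Matrix

/-- `J = [[0, I₂], [−I₂, 0]]`, the standard symplectic form. -/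
def sympJ : Matrix (Fin 2 ⊕ Fin 2) (Fin 2 ⊕ Fin 2) ℤ := fromBlocks 0 1 (-1) 0

/-- `M = [[A,B],[C,D]] ∈ Sp(4,ℤ)`: `M·J·Mᵀ = J`. -/
def IsSp4 (A B C D : Matrix (Fin 2) (Fin 2) ℤ) : Prop :=
  fromBlocks A B C D * sympJ * (fromBlocks A B C D)ᵀ = sympJ

/-- The period matrix Ω = (i√3/3)·[[2,1],[1,2]] of the genus-2 curve y² = x⁶ − 1. -/
noncomputable def ΩsexticCurve : Matrix (Fin 2) (Fin 2) ℂ :=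
  (Complex.I * (Real.sqrt 3 : ℝ) / 3) • !![2, 1; 1, 2]

theorem sexticCurve_scalar_sq : (Complex.I * (Real.sqrt 3 : ℝ) / 3) ^ 2 = -1 / 3 := by
  have h : ((Real.sqrt 3 : ℝ) : ℂ) ^ 2 = 3 := by
    rw [← Complex.ofReal_pow, Real.sq_sqrt (by norm_num)]
    norm_num
  rw [div_pow, mul_pow, Complex.I_sq, h]
  norm_num

theorem det_ΩsexticCurve : ΩsexticCurve.det = -1 := by
  rw [ΩsexticCurve, det_smul, det_fin_two_of, Fintype.card_fin, sexticCurve_scalar_sq]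
  norm_num

theorem sextic_curve_example_symplectic_and_axio_dilaton (k : ℤ) :
    -- M_k ∈ Sp(4,ℤ), where A, B, C, D are its 2×2 blocks
    IsSp4 !![2, -1 - 3 * k; -1 + k, 1 + k] !![-3, -3; 1, 2]
      !![0, k; k, k] !![1, 1; 1, 2] ∧
    -- det(Ω) = −1
    ΩsexticCurve.det = -1 ∧
    -- det((AΩ+B)(CΩ+D)⁻¹) = ((1+3k²)λ − 3)/(−k²λ + 1) at λ = det(Ω)
    (((!![2, -1 - 3 * k; -1 + k, 1 + k] : Matrix (Fin 2) (Fin 2) ℤ).map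
            (Int.cast : ℤ → ℂ) * ΩsexticCurve +
          (!![-3, -3; 1, 2] : Matrix (Fin 2) (Fin 2) ℤ).map (Int.cast : ℤ → ℂ)) *
        ((!![0, k; k, k] : Matrix (Fin 2) (Fin 2) ℤ).map (Int.cast : ℤ → ℂ) *
            ΩsexticCurve +
          (!![1, 1; 1, 2] : Matrix (Fin 2) (Fin 2) ℤ).map (Int.cast : ℤ → ℂ))⁻¹).det =
      ((1 + 3 * (k : ℂ) ^ 2) * ΩsexticCurve.det - 3) /
        (-(k : ℂ) ^ 2 * ΩsexticCurve.det + 1) ∧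
    -- [[1+3k², −3], [−k², 1]] ∈ SL(2,ℤ)
    (!![1 + 3 * k ^ 2, -3; -k ^ 2, 1] : Matrix (Fin 2) (Fin 2) ℤ).det = 1 := by
  have ht := sexticCurve_scalar_sq
  refine ⟨?_, det_ΩsexticCurve, ?_, ?_⟩
  · rw [IsSp4, sympJ, fromBlocks_transpose, fromBlocks_multiply, fromBlocks_multiply,
      fromBlocks_inj]
    refine ⟨?_, ?_, ?_, ?_⟩ <;> ext i j <;> fin_cases i <;> fin_cases j <;>
      simp [vecMul, dotProduct] <;> ring
  · rw [det_mul, det_nonsing_inv, Ring.inverse_eq_inv', ← div_eq_mul_inv, det_ΩsexticCurve,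
      ΩsexticCurve]
    generalize Complex.I * (Real.sqrt 3 : ℝ) / 3 = t at ht
    congr 1
    · simp [det_fin_two, Matrix.mul_apply, Fin.sum_univ_two]
      linear_combination (9 * (k : ℂ) ^ 2 + 3) * ht
    · simp [det_fin_two, Matrix.mul_apply, Fin.sum_univ_two]
      linear_combination (-3 * (k : ℂ) ^ 2) * ht
  · rw [det_fin_two_of]
    ring
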